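/- Let k be an algebraically closed field of characteristic 2 and let R = k[X,Y,Z]/(X³+Y³+Z³). Then for every e ≥ 2, writing q = 2^e, the k-vector space of triples (A,B,C) ∈ R_{q/2} × R_{q/2} × R_{q/2} satisfying A·X^q + B·Y^q + C·Z^q = 0 in R has dimension exactly 2, where R_{q/2} denotes the homogeneous component of R of degree q/2. -/

import Mathlib

open MvPolynomial

/-- The image in `R = k[X,Y,Z]/I` of the degree-`m` homogeneous component of the
polynomial ring: this is the degree-`m` component `R_m` of the graded ring `R`. -/
noncomputable def degreeComponent (k : Type*) [Field k]
    (I : Ideal (MvPolynomial (Fin 3) k)) (m : ℕ) :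
    Submodule k (MvPolynomial (Fin 3) k ⧸ I) :=
  (homogeneousSubmodule (Fin 3) k m).map (Ideal.Quotient.mkₐ k I).toLinearMap

set_option maxHeartbeats 1000000 in
/-- The `k`-linear map `R³ → R`, `(A,B,C) ↦ A·X^q + B·Y^q + C·Z^q`, on `R = k[X,Y,Z]/I`. -/
noncomputable def syzygyMap (k : Type*) [Field k]
    (I : Ideal (MvPolynomial (Fin 3) k)) (q : ℕ) :
    (MvPolynomial (Fin 3) k ⧸ I) × (MvPolynomial (Fin 3) k ⧸ I) ×
        (MvPolynomial (Fin 3) k ⧸ I) →ₗ[k] MvPolynomial (Fin 3) k ⧸ I :=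
  (LinearMap.mulLeft k (Ideal.Quotient.mk I (X 0 ^ q))).comp (LinearMap.fst k _ _) +
    (LinearMap.mulLeft k (Ideal.Quotient.mk I (X 1 ^ q))).comp
      ((LinearMap.fst k _ _).comp (LinearMap.snd k _ _)) +
    (LinearMap.mulLeft k (Ideal.Quotient.mk I (X 2 ^ q))).comp
      ((LinearMap.snd k _ _).comp (LinearMap.snd k _ _))

/-- The `k`-vector space of triples `(A,B,C) ∈ (R_m)³` with `A·X^q + B·Y^q + C·Z^q = 0`
in `R = k[X,Y,Z]/I`, i.e. the space of global syzygies of total degree `m + q`. -/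
noncomputable def syzygySpace (k : Type*) [Field k]
    (I : Ideal (MvPolynomial (Fin 3) k)) (m q : ℕ) :
    Submodule k ((MvPolynomial (Fin 3) k ⧸ I) × (MvPolynomial (Fin 3) k ⧸ I) ×
      (MvPolynomial (Fin 3) k ⧸ I)) :=
  ((degreeComponent k I m).prod ((degreeComponent k I m).prod (degreeComponent k I m))) ⊓
    LinearMap.ker (syzygyMap k I q)

theorem dvd_of_dvd_pow_mul {R : Type*} [CommRing R] {x y : R} (hx : x ∈ nonZeroDivisors R)
    (hy : ∀ a, x ∣ y * a → x ∣ a) (m n : ℕ) (a : R) (h : x ^ m ∣ y ^ n * a) : x ^ m ∣ a := by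
  have hy' : ∀ n a, x ∣ y ^ n * a → x ∣ a := by
    intro n
    induction n with
    | zero => simp
    | succ n ih => intro a h; exact hy a (ih _ (by rwa [← mul_assoc, ← pow_succ]))
  induction m generalizing a with
  | zero => simp
  | succ m ih =>
    obtain ⟨a, rfl⟩ := hy' n a ((dvd_pow_self x m.succ_ne_zero).trans h)
    obtain ⟨b, hb⟩ := h
    rw [pow_succ']
    refine mul_dvd_mul_left x (ih a ⟨b, ?_⟩)
    rw [← mul_cancel_left_mem_nonZeroDivisors hx]
    linear_combination hb

theorem dvd_of_prime_of_dvd_mul {R : Type*} [CommRing R] [IsDomain R] {p f a : R} (hp : Prime p)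
    (hf : ¬ p ∣ f) (h : f ∣ p * a) : f ∣ a := by
  obtain ⟨b, hb⟩ := h
  obtain ⟨c, rfl⟩ := (hp.dvd_or_dvd ⟨a, hb.symm⟩).resolve_left hf
  exact ⟨c, mul_left_cancel₀ hp.ne_zero (by linear_combination hb)⟩

/-- The equation of the Fermat cubic. -/
noncomputable abbrev fermatCubic (k : Type*) [Field k] : MvPolynomial (Fin 3) k :=
  X 0 ^ 3 + X 1 ^ 3 + X 2 ^ 3

section

variable (k : Type*) [Field k]

/-- Substitution of `0` for the first variable. -/
noncomputable def substZero : MvPolynomial (Fin 3) k →ₐ[k] MvPolynomial (Fin 3) k :=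
  aeval ![0, X 1, X 2]

theorem X_zero_dvd_sub_substZero (p : MvPolynomial (Fin 3) k) : X 0 ∣ p - substZero k p := by
  rw [← Ideal.mem_span_singleton, ← Ideal.Quotient.mk_eq_mk_iff_sub_mem]
  have h : Ideal.Quotient.mkₐ k (Ideal.span {(X 0 : MvPolynomial (Fin 3) k)}) =
      (Ideal.Quotient.mkₐ k (Ideal.span {X 0})).comp (substZero k) := by
    ext i
    fin_cases i <;> simp [substZero]
  exact DFunLike.congr_fun h p

theorem not_X_dvd_of_eval_ne_zero {i : Fin 3} (hi : i ≠ 2) {f : MvPolynomial (Fin 3) k}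
    (hf : eval (Pi.single 2 1) f ≠ 0) : ¬ X i ∣ f := by
  rintro ⟨g, rfl⟩
  simp [hi] at hf

theorem mk_X_zero_mem_nonZeroDivisors :
    Ideal.Quotient.mk (Ideal.span {fermatCubic k}) (X 0) ∈ nonZeroDivisors _ := by
  rw [mem_nonZeroDivisors_iff_left]
  intro a ha
  obtain ⟨a, rfl⟩ := Ideal.Quotient.mk_surjective a
  rw [← map_mul, Ideal.Quotient.eq_zero_iff_mem, Ideal.mem_span_singleton] at ha
  rw [Ideal.Quotient.eq_zero_iff_mem, Ideal.mem_span_singleton]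
  exact dvd_of_prime_of_dvd_mul X_prime
    (not_X_dvd_of_eval_ne_zero k (by decide) (by simp)) ha

theorem mk_X_zero_dvd_of_dvd_mk_X_one_mul
    (a : MvPolynomial (Fin 3) k ⧸ Ideal.span {fermatCubic k})
    (h : Ideal.Quotient.mk _ (X 0) ∣ Ideal.Quotient.mk _ (X 1) * a) :
    Ideal.Quotient.mk _ (X 0) ∣ a := by
  obtain ⟨a, rfl⟩ := Ideal.Quotient.mk_surjective a
  obtain ⟨b, hb⟩ := h
  obtain ⟨b, rfl⟩ := Ideal.Quotient.mk_surjective b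
  rw [← map_mul, ← map_mul, Ideal.Quotient.mk_eq_mk_iff_sub_mem, Ideal.mem_span_singleton] at hb
  have h0 : substZero k (fermatCubic k) ∣ X 1 * substZero k a := by
    simpa [substZero] using map_dvd (substZero k) hb
  obtain ⟨c, hc⟩ := dvd_of_prime_of_dvd_mul X_prime
    (not_X_dvd_of_eval_ne_zero k (by decide) (by simp [substZero])) h0
  obtain ⟨d, hd⟩ := X_zero_dvd_sub_substZero k a
  obtain ⟨f, hf⟩ := X_zero_dvd_sub_substZero k (fermatCubic k)
  refine ⟨Ideal.Quotient.mk _ (d - f * c), ?_⟩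
  rw [← map_mul, Ideal.Quotient.mk_eq_mk_iff_sub_mem, Ideal.mem_span_singleton]
  exact ⟨c, by linear_combination hd + hc - c * hf⟩

theorem exists_smul_of_mk_X_zero_pow_dvd {n : ℕ}
    {w : MvPolynomial (Fin 3) k ⧸ Ideal.span {fermatCubic k}}
    (hw : w ∈ degreeComponent k (Ideal.span {fermatCubic k}) n)
    (h : Ideal.Quotient.mk _ (X 0) ^ n ∣ w) :
    ∃ c : k, w = c • Ideal.Quotient.mk _ (X 0) ^ n := by
  obtain ⟨w, hw, rfl⟩ := hw
  obtain ⟨b, hb⟩ := h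
  obtain ⟨b, rfl⟩ := Ideal.Quotient.mk_surjective b
  simp only [AlgHom.toLinearMap_apply, Ideal.Quotient.mkₐ_eq_mk] at hb ⊢
  rw [← map_pow, ← map_mul, Ideal.Quotient.mk_eq_mk_iff_sub_mem] at hb
  let : GradedAlgebra (homogeneousSubmodule (Fin 3) k) := MvPolynomial.gradedAlgebra
  have hX : (X 0 ^ n : MvPolynomial (Fin 3) k) ∈ homogeneousSubmodule (Fin 3) k n :=
    isHomogeneous_X_pow _ _
  have hF : (Ideal.span {fermatCubic k}).IsHomogeneous (homogeneousSubmodule (Fin 3) k) := by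
    refine Ideal.homogeneous_span _ _ fun f hf ↦ ⟨3, ?_⟩
    rw [Set.mem_singleton_iff.1 hf]
    exact ((isHomogeneous_X_pow _ _).add (isHomogeneous_X_pow _ _)).add (isHomogeneous_X_pow _ _)
  have hc : homogeneousComponent n (X 0 ^ n * b) = X 0 ^ n * C (coeff 0 b) := by
    rw [← homogeneousComponent_zero, ← decomposition.decompose'_apply,
      ← decomposition.decompose'_apply]
    exact DirectSum.coe_decompose_mul_add_of_left_mem (j := 0) _ hX
  have hn := (mem_iff_homogeneousComponent_mem hF _).1 hb n
  rw [map_sub, homogeneousComponent_of_mem hw, if_pos rfl, hc] at hn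
  refine ⟨coeff 0 b, ?_⟩
  rw [← map_pow, ← Ideal.Quotient.mkₐ_eq_mk k, ← map_smul, Ideal.Quotient.mkₐ_eq_mk,
    Ideal.Quotient.mk_eq_mk_iff_sub_mem, smul_eq_C_mul, mul_comm]
  exact hn

theorem mul_mem_degreeComponent {I : Ideal (MvPolynomial (Fin 3) k)} {m n : ℕ}
    {a b : MvPolynomial (Fin 3) k ⧸ I} (ha : a ∈ degreeComponent k I m)
    (hb : b ∈ degreeComponent k I n) : a * b ∈ degreeComponent k I (m + n) := by
  obtain ⟨a, ha, rfl⟩ := ha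
  obtain ⟨b, hb, rfl⟩ := hb
  exact ⟨a * b, IsHomogeneous.mul ha hb, by simp⟩

theorem mk_X_pow_mem_degreeComponent (I : Ideal (MvPolynomial (Fin 3) k)) (i : Fin 3) (n : ℕ) :
    Ideal.Quotient.mk I (X i) ^ n ∈ degreeComponent k I n :=
  ⟨X i ^ n, isHomogeneous_X_pow _ _, by simp⟩

theorem mem_syzygySpace {I : Ideal (MvPolynomial (Fin 3) k)} {m q : ℕ}
    {s : (MvPolynomial (Fin 3) k ⧸ I) × (MvPolynomial (Fin 3) k ⧸ I) ×
      (MvPolynomial (Fin 3) k ⧸ I)} :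
    s ∈ syzygySpace k I m q ↔
      (s.1 ∈ degreeComponent k I m ∧ s.2.1 ∈ degreeComponent k I m ∧
        s.2.2 ∈ degreeComponent k I m) ∧
      Ideal.Quotient.mk I (X 0) ^ q * s.1 + Ideal.Quotient.mk I (X 1) ^ q * s.2.1 +
        Ideal.Quotient.mk I (X 2) ^ q * s.2.2 = 0 := by
  simp [syzygySpace, syzygyMap, Submodule.mem_prod]

theorem mk_X_pow_two_pow_cube_add [CharP k 2] (e : ℕ) :
    (Ideal.Quotient.mk (Ideal.span {fermatCubic k}) (X 0) ^ 2 ^ e) ^ 3 +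
      (Ideal.Quotient.mk (Ideal.span {fermatCubic k}) (X 1) ^ 2 ^ e) ^ 3 +
      (Ideal.Quotient.mk (Ideal.span {fermatCubic k}) (X 2) ^ 2 ^ e) ^ 3 = 0 := by
  have h : fermatCubic k ^ 2 ^ e = (X 0 ^ 2 ^ e) ^ 3 + (X 1 ^ 2 ^ e) ^ 3 + (X 2 ^ 2 ^ e) ^ 3 := by
    simp only [fermatCubic, add_pow_char_pow, ← pow_mul, mul_comm]
  rw [← map_pow, ← map_pow, ← map_pow, ← map_pow, ← map_pow, ← map_pow, ← map_add, ← map_add, ← h,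
    Ideal.Quotient.eq_zero_iff_mem, Ideal.mem_span_singleton]
  exact dvd_pow_self _ (by positivity)

theorem two_eq_zero_quotient [CharP k 2] (I : Ideal (MvPolynomial (Fin 3) k)) :
    (2 : MvPolynomial (Fin 3) k ⧸ I) = 0 := by
  rw [← map_ofNat (Ideal.Quotient.mk I) 2, CharTwo.two_eq_zero, map_zero]

theorem quotient_smul_def (I : Ideal (MvPolynomial (Fin 3) k)) (r : k)
    (a : MvPolynomial (Fin 3) k ⧸ I) : r • a = algebraMap k (MvPolynomial (Fin 3) k ⧸ I) r * a :=
  Algebra.smul_def r a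

theorem syzygySpace_fermatCubic_eq_span [CharP k 2] (e : ℕ) :
    let x (i : Fin 3) := Ideal.Quotient.mk (Ideal.span {fermatCubic k}) (X i) ^ 2 ^ e
    syzygySpace k (Ideal.span {fermatCubic k}) (2 * 2 ^ e) (4 * 2 ^ e) =
      Submodule.span k {(x 0 ^ 2, x 1 ^ 2, x 2 ^ 2), (x 1 * x 2, x 0 * x 2, x 0 * x 1)} := by
  intro x
  have h2 := two_eq_zero_quotient k (Ideal.span {fermatCubic k})
  have hx : x 0 ^ 3 + x 1 ^ 3 + x 2 ^ 3 = 0 := mk_X_pow_two_pow_cube_add k e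
  have h4 (i) : Ideal.Quotient.mk (Ideal.span {fermatCubic k}) (X i) ^ (4 * 2 ^ e) = x i ^ 4 := by
    rw [mul_comm, pow_mul]
  have hdeg (i) : x i ∈ degreeComponent k (Ideal.span {fermatCubic k}) (2 ^ e) :=
    mk_X_pow_mem_degreeComponent k _ i _
  have hdeg2 (i j) : x i * x j ∈ degreeComponent k (Ideal.span {fermatCubic k}) (2 * 2 ^ e) := by
    rw [two_mul]
    exact mul_mem_degreeComponent k (hdeg i) (hdeg j)
  have hdeg4 (i j) {a} (ha : a ∈ degreeComponent k (Ideal.span {fermatCubic k}) (2 * 2 ^ e)) :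
      x i * x j * a ∈ degreeComponent k (Ideal.span {fermatCubic k}) (4 * 2 ^ e) := by
    rw [show 4 * 2 ^ e = 2 * 2 ^ e + 2 * 2 ^ e by ring]
    exact mul_mem_degreeComponent k (hdeg2 i j) ha
  have hx0 : x 0 ∈ nonZeroDivisors _ := pow_mem (mk_X_zero_mem_nonZeroDivisors k) _
  have hdvd {w} (hw : w ∈ degreeComponent k (Ideal.span {fermatCubic k}) (4 * 2 ^ e))
      (h : x 0 ^ 4 ∣ x 1 ^ 4 * w) : ∃ c : k, w = c • x 0 ^ 4 := by
    rw [← h4, ← h4] at h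
    rw [← h4]
    exact exists_smul_of_mk_X_zero_pow_dvd k hw (dvd_of_dvd_pow_mul
      (mk_X_zero_mem_nonZeroDivisors k) (mk_X_zero_dvd_of_dvd_mk_X_one_mul k) _ _ _ h)
  apply le_antisymm
  · rintro ⟨a, b, c⟩ hs
    rw [mem_syzygySpace] at hs
    obtain ⟨⟨-, hb, hc⟩, hs⟩ := hs
    simp only [h4] at hs hb hc
    obtain ⟨r, hr⟩ := hdvd (Submodule.add_mem _ (hdeg4 0 1 hb) (hdeg4 0 2 hc))
      ⟨x 0 * x 1 * a + x 1 * x 2 * c, by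
        linear_combination (x 0 * x 1) * hs + (x 0 * x 1 * x 2 * c) * hx
          - (x 0 ^ 5 * x 1 * a + x 0 * x 1 * x 2 ^ 4 * c + x 0 ^ 4 * x 1 * x 2 * c) * h2⟩
    obtain ⟨t, ht⟩ := hdvd (Submodule.add_mem _ (hdeg4 2 2 hb) (hdeg4 1 1 hc))
      ⟨x 2 ^ 2 * a + x 0 ^ 2 * c, by
        linear_combination x 2 ^ 2 * hs + c * (x 1 ^ 3 - x 2 ^ 3 - x 0 ^ 3) * hx
          + (c * x 0 ^ 3 * x 2 ^ 3 - x 2 ^ 2 * x 0 ^ 4 * a) * h2⟩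
    rw [quotient_smul_def] at hr ht
    rw [Submodule.mem_span_pair]
    refine ⟨r, t, ?_⟩
    simp only [Prod.smul_mk, Prod.mk_add_mk, Prod.mk.injEq, quotient_smul_def]
    set ρ := algebraMap k (MvPolynomial (Fin 3) k ⧸ Ideal.span {fermatCubic k}) r
    set τ := algebraMap k (MvPolynomial (Fin 3) k ⧸ Ideal.span {fermatCubic k}) t
    have hB : ρ * x 1 ^ 2 + τ * (x 0 * x 2) = b := by
      rw [← mul_cancel_left_mem_nonZeroDivisors (pow_mem hx0 4)]
      linear_combination (x 0 * b) * hx - x 1 ^ 2 * hr - (x 0 * x 2) * ht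
        + (x 0 * x 1 ^ 2 * x 2 * c - x 0 ^ 4 * b) * h2
    have hC : ρ * x 2 ^ 2 + τ * (x 0 * x 1) = c := by
      rw [← mul_cancel_left_mem_nonZeroDivisors (pow_mem hx0 4)]
      linear_combination (x 0 * c) * hx - x 2 ^ 2 * hr - (x 0 * x 1) * ht
        + (x 0 * x 1 * x 2 ^ 2 * b - x 0 ^ 4 * c) * h2
    refine ⟨?_, hB, hC⟩
    rw [← mul_cancel_left_mem_nonZeroDivisors (pow_mem hx0 4)]
    linear_combination (ρ * (x 0 ^ 3 + x 1 ^ 3 + x 2 ^ 3) + τ * x 0 * x 1 * x 2) * hx - hs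
      - x 1 ^ 4 * hB - x 2 ^ 4 * hC - ρ * (x 0 ^ 3 * x 1 ^ 3 + x 0 ^ 3 * x 2 ^ 3 + x 1 ^ 3 * x 2 ^ 3) * h2
  · rw [Submodule.span_le, Set.insert_subset_iff, Set.singleton_subset_iff]
    simp only [SetLike.mem_coe, mem_syzygySpace, h4]
    refine ⟨⟨⟨?_, ?_, ?_⟩, ?_⟩, ⟨hdeg2 _ _, hdeg2 _ _, hdeg2 _ _⟩, ?_⟩
    iterate 3 rw [pow_two]; exact hdeg2 _ _
    · linear_combination (x 0 ^ 3 + x 1 ^ 3 + x 2 ^ 3) * hx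
        - (x 0 ^ 3 * x 1 ^ 3 + x 0 ^ 3 * x 2 ^ 3 + x 1 ^ 3 * x 2 ^ 3) * h2
    · linear_combination (x 0 * x 1 * x 2) * hx

theorem linearIndependent_syzygies [CharP k 2] (e : ℕ) :
    let x (i : Fin 3) := Ideal.Quotient.mk (Ideal.span {fermatCubic k}) (X i) ^ 2 ^ e
    LinearIndependent k ![(x 0 ^ 2, x 1 ^ 2, x 2 ^ 2), (x 1 * x 2, x 0 * x 2, x 0 * x 1)] := by
  intro x
  have h2 := two_eq_zero_quotient k (Ideal.span {fermatCubic k})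
  have hx : x 0 ^ 3 + x 1 ^ 3 + x 2 ^ 3 = 0 := mk_X_pow_two_pow_cube_add k e
  have hx0 : x 0 ^ 4 ∈ nonZeroDivisors _ :=
    pow_mem (pow_mem (mk_X_zero_mem_nonZeroDivisors k) _) _
  have : Nontrivial (MvPolynomial (Fin 3) k ⧸ Ideal.span {fermatCubic k}) := by
    rw [Ideal.Quotient.nontrivial_iff, Ne, Ideal.eq_top_iff_one, Ideal.mem_span_singleton]
    intro h
    simpa using map_dvd (eval 0) h
  have hzero {r : k} (h : x 0 ^ 4 * algebraMap k _ r = 0) : r = 0 := by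
    rw [mul_left_mem_nonZeroDivisors_eq_zero_iff hx0] at h
    simpa using h
  rw [LinearIndependent.pair_iff]
  intro r t h
  simp only [Prod.smul_mk, Prod.mk_add_mk, Prod.mk_eq_zero, quotient_smul_def] at h
  obtain ⟨-, hb, hc⟩ := h
  set ρ := algebraMap k (MvPolynomial (Fin 3) k ⧸ Ideal.span {fermatCubic k}) r
  set τ := algebraMap k (MvPolynomial (Fin 3) k ⧸ Ideal.span {fermatCubic k}) t
  refine ⟨hzero ?_, hzero ?_⟩
  · linear_combination (x 0 * ρ) * hx - (x 0 * x 1) * hb - (x 0 * x 2) * hc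
      + (τ * x 0 ^ 2 * x 1 * x 2) * h2
  · linear_combination (x 0 * τ) * hx - x 2 ^ 2 * hb - x 1 ^ 2 * hc
      + (ρ * x 1 ^ 2 * x 2 ^ 2) * h2

end

/-- For the Fermat cubic `R = k[X,Y,Z]/(X³+Y³+Z³)` in characteristic `2` and `q = 2^e`
with `e ≥ 2`, the space of triples `(A,B,C) ∈ (R_{q/2})³` with `A·X^q + B·Y^q + C·Z^q = 0`
in `R` has dimension exactly `2`. -/
theorem fermat_cubic_frobenius_syzygies_char_two
    (k : Type*) [Field k] [IsAlgClosed k] [CharP k 2] :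
    ∀ e : ℕ, 2 ≤ e →
      Module.finrank k
        (syzygySpace k
          (Ideal.span {(X 0 ^ 3 + X 1 ^ 3 + X 2 ^ 3 : MvPolynomial (Fin 3) k)})
          (2 ^ e / 2) (2 ^ e)) = 2 := by
  intro e he
  obtain ⟨e, rfl⟩ := Nat.exists_eq_add_of_le' he
  rw [show 2 ^ (e + 2) = 4 * 2 ^ e by ring, show 4 * 2 ^ e / 2 = 2 * 2 ^ e by omega,
    syzygySpace_fermatCubic_eq_span, ← Matrix.range_cons_cons_empty _ _ ![],
    finrank_span_eq_card (linearIndependent_syzygies k e), Fintype.card_fin]
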